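/- There exists an absolute constant c > 0 such that for every combinatorial market and every k ∈ {1, …, m}, there exists a competitive bundling equilibrium whose welfare is at least c · W_k / (√(k·m) · (log(m) + 2)), where W_k denotes the maximum welfare over allocations (S_1, …, S_n) in which every nonempty S_i satisfies k ≤ |S_i| < 2k. -/

import Mathlib

open Finset

/-- A combinatorial market with `n` consumers and `m` items. Each consumer has a
normalized (`v i ∅ = 0`) and monotone valuation over subsets of items. -/
structure Market (n m : ℕ) where
  v : Fin n → Finset (Fin m) → ℝ
  v_empty : ∀ i, v i ∅ = 0
  v_mono : ∀ i, ∀ S T : Finset (Fin m), S ⊆ T → v i S ≤ v i T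

/-- An allocation assigns pairwise disjoint sets of items to consumers. -/
def IsAllocation {n m : ℕ} (S : Fin n → Finset (Fin m)) : Prop :=
  ∀ i j : Fin n, i ≠ j → Disjoint (S i) (S j)

/-- The welfare of an allocation. -/
def allocWelfare {n m : ℕ} (Mk : Market n m) (S : Fin n → Finset (Fin m)) : ℝ :=
  ∑ i, Mk.v i (S i)

/-- The optimal welfare over all allocations. -/
noncomputable def OPT {n m : ℕ} (Mk : Market n m) : ℝ :=
  sSup {w : ℝ | ∃ S : Fin n → Finset (Fin m), IsAllocation S ∧ allocWelfare Mk S = w}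

/-- A competitive bundling equilibrium: a partition of the items into nonempty bundles,
nonnegative bundle prices, and an assignment of every bundle to a consumer (market
clearance), such that every consumer's assigned set of bundles maximizes his profit
over all sets of bundles. -/
structure CBE {n m : ℕ} (Mk : Market n m) where
  bundles : Finset (Finset (Fin m))
  price : Finset (Fin m) → ℝ
  assign : Finset (Fin m) → Fin n
  bundles_nonempty : ∀ b ∈ bundles, b.Nonempty
  bundles_disjoint : ∀ b ∈ bundles, ∀ b' ∈ bundles, b ≠ b' → Disjoint b b'
  bundles_cover : bundles.biUnion id = Finset.univ
  price_nonneg : ∀ b ∈ bundles, 0 ≤ price b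
  profit_max : ∀ i : Fin n, ∀ T : Finset (Finset (Fin m)), T ⊆ bundles →
    Mk.v i ((bundles.filter fun b => assign b = i).biUnion id)
        - ∑ b ∈ bundles.filter fun b => assign b = i, price b
      ≥ Mk.v i (T.biUnion id) - ∑ b ∈ T, price b

/-- The welfare of a competitive bundling equilibrium. -/
def CBE.welfare {n m : ℕ} {Mk : Market n m} (E : CBE Mk) : ℝ :=
  ∑ i, Mk.v i ((E.bundles.filter fun b => E.assign b = i).biUnion id)

/-- The revenue of a competitive bundling equilibrium. -/
def CBE.revenue {n m : ℕ} {Mk : Market n m} (E : CBE Mk) : ℝ :=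
  ∑ b ∈ E.bundles, E.price b

/-- A market is multi-unit if valuations depend only on the number of items. -/
def MultiUnit {n m : ℕ} (Mk : Market n m) : Prop :=
  ∀ i, ∀ S T : Finset (Fin m), S.card = T.card → Mk.v i S = Mk.v i T

/-- `T` is a union of bundles of `H` and unheld items. -/
def Adm {n s : ℕ} (H : Fin n → Finset (Fin s)) (T : Finset (Fin s)) : Prop :=
  ∀ j, H j ⊆ T ∨ Disjoint (H j) T

/-- Consumer `i` is `δ`-happy. -/
def Happy {n s : ℕ} (w : Fin n → Finset (Fin s) → ℝ) (δ : ℝ) (H : Fin n → Finset (Fin s))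
    (q : Fin s → ℝ) (i : Fin n) : Prop :=
  ∀ T, Adm H T → w i T - ∑ x ∈ T, q x - δ ≤ w i (H i) - ∑ x ∈ H i, q x

structure Basic {n s : ℕ} (p : ℝ) (H : Fin n → Finset (Fin s)) (q : Fin s → ℝ) : Prop where
  disj : ∀ i j, i ≠ j → Disjoint (H i) (H j)
  low : ∀ x, p ≤ q x
  unheld : ∀ x, (∀ j, x ∉ H j) → q x = p

lemma auction_step {n s : ℕ} (w : Fin n → Finset (Fin s) → ℝ) (w0 : ∀ i, w i ∅ = 0)
    (p δ : ℝ) (hδ : 0 < δ) (H : Fin n → Finset (Fin s)) (q : Fin s → ℝ)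
    (hB : Basic p H q) (hH : ∀ i, (H i).Nonempty → Happy w δ H q i)
    (hn : ¬ ∀ i, Happy w δ H q i) :
    ∃ (H' : Fin n → Finset (Fin s)) (q' : Fin s → ℝ), Basic p H' q' ∧
      (∀ i, (H' i).Nonempty → Happy w δ H' q' i) ∧ ∑ x, q' x = ∑ x, q x + δ := by
  classical
  push Not at hn
  obtain ⟨i, hi⟩ := hn
  have hHi : H i = ∅ := by
    by_contra h
    exact hi (hH i (Finset.nonempty_iff_ne_empty.mpr h))
  unfold Happy at hi
  push Not at hi
  obtain ⟨T0, hT0, hlt0⟩ := hi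
  obtain ⟨T, hT, hmax⟩ := Finset.exists_max_image (univ.filter (fun T => Adm H T))
    (fun T => w i T - ∑ x ∈ T, q x) ⟨T0, by simpa using hT0⟩
  have hTA : Adm H T := by simpa using hT
  have hm0 := hmax T0 (by simpa using hT0)
  rw [hHi, w0] at hlt0
  simp only [sum_empty] at hlt0
  have hTne : T.Nonempty := by
    by_contra h
    rw [Finset.not_nonempty_iff_eq_empty] at h
    rw [h, w0] at hm0
    simp only [sum_empty] at hm0
    linarith
  obtain ⟨x0, hx0⟩ := hTne
  let H' : Fin n → Finset (Fin s) := fun j => if j = i then T else H j \ T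
  let q' : Fin s → ℝ := fun x => q x + if x = x0 then δ else 0
  have hqq : ∀ x, q x ≤ q' x := fun x => by
    simp only [q']; split_ifs <;> linarith
  have hH'i : H' i = T := by simp [H']
  have hH'j : ∀ j, j ≠ i → H' j = H j \ T := fun j hj => by simp [H', hj]
  have hadm : ∀ T', Adm H' T' → Adm H T' := by
    intro T' h j
    by_cases hj : j = i
    · subst hj; left; rw [hHi]; simp
    rcases hTA j with h1 | h1
    · have h2 := h i
      rw [hH'i] at h2
      rcases h2 with h2 | h2
      · exact Or.inl (h1.trans h2)
      · exact Or.inr (h2.mono_left h1)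
    · have h2 := h j
      rw [hH'j j hj, Finset.sdiff_eq_self_of_disjoint h1] at h2
      exact h2
  have hsumle : ∀ T' : Finset (Fin s), ∑ x ∈ T', q x ≤ ∑ x ∈ T', q' x :=
    fun T' => Finset.sum_le_sum fun x _ => hqq x
  refine ⟨H', q', ⟨?_, ?_, ?_⟩, ?_, ?_⟩
  · intro a b hab
    by_cases ha : a = i
    · subst ha
      rw [hH'i, hH'j b (Ne.symm hab)]
      exact Finset.disjoint_sdiff
    · by_cases hb : b = i
      · subst hb
        rw [hH'i, hH'j a hab]
        exact Finset.sdiff_disjoint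
      · rw [hH'j a ha, hH'j b hb]
        exact (hB.disj a b hab).mono Finset.sdiff_subset Finset.sdiff_subset
  · exact fun x => (hB.low x).trans (hqq x)
  · intro x hx
    have hxT : x ∉ T := by have := hx i; rwa [hH'i] at this
    have hne : x ≠ x0 := fun h => hxT (h ▸ hx0)
    simp only [q', hne, if_false, add_zero]
    apply hB.unheld
    intro j hj
    by_cases hji : j = i
    · subst hji; rw [hHi] at hj; simp at hj
    · apply hx j
      rw [hH'j j hji]
      simp [hj, hxT]
  · intro j hj T' hT'
    have hA := hadm T' hT'
    have h1 := hsumle T'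
    by_cases hji : j = i
    · subst hji
      rw [hH'i]
      have h2 := hmax T' (by simpa using hA)
      have h3 : ∑ x ∈ T, q' x = ∑ x ∈ T, q x + δ := by
        simp only [q', Finset.sum_add_distrib, Finset.sum_ite_eq', hx0, if_true]
      linarith
    · rw [hH'j j hji] at hj ⊢
      rcases hTA j with h2 | h2
      · rw [Finset.sdiff_eq_empty_iff_subset.mpr h2] at hj
        simp at hj
      · rw [Finset.sdiff_eq_self_of_disjoint h2] at hj ⊢
        have h3 := hH j hj T' hA
        have h4 : ∑ x ∈ H j, q' x = ∑ x ∈ H j, q x := by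
          apply Finset.sum_congr rfl
          intro x hx
          have : x ≠ x0 := fun h => (Finset.disjoint_left.mp h2 hx) (h ▸ hx0)
          simp [q', this]
        linarith
  · simp only [q', Finset.sum_add_distrib, Finset.sum_ite_eq', Finset.mem_univ, if_true]

lemma price_bound {n s : ℕ} (w : Fin n → Finset (Fin s) → ℝ) (w0 : ∀ i, w i ∅ = 0)
    (p δ V : ℝ) (hp : 0 ≤ p) (hδ : 0 ≤ δ) (hV0 : 0 ≤ V) (hV : ∀ i S, w i S ≤ V)
    (H : Fin n → Finset (Fin s)) (q : Fin s → ℝ)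
    (hB : Basic p H q) (hH : ∀ i, (H i).Nonempty → Happy w δ H q i) (x : Fin s) :
    q x ≤ p + V + δ := by
  by_cases h : ∀ j, x ∉ H j
  · rw [hB.unheld x h]; linarith
  · push Not at h
    obtain ⟨j, hj⟩ := h
    have h1 := hH j ⟨x, hj⟩ ∅ (fun j => Or.inr (by simp))
    simp only [w0, sum_empty] at h1
    have h2 : q x ≤ ∑ y ∈ H j, q y :=
      Finset.single_le_sum (f := q) (fun y _ => hp.trans (hB.low y)) hj
    have := hV j (H j)
    linarith

lemma auction_delta {n s : ℕ} (w : Fin n → Finset (Fin s) → ℝ) (w0 : ∀ i, w i ∅ = 0)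
    (p δ V : ℝ) (hp : 0 ≤ p) (hδ : 0 < δ) (hV0 : 0 ≤ V) (hV : ∀ i S, w i S ≤ V) :
    ∃ (H : Fin n → Finset (Fin s)) (q : Fin s → ℝ), Basic p H q ∧
      ∀ i, Happy w δ H q i := by
  by_contra hcon
  push Not at hcon
  have key : ∀ N : ℕ, ∃ (H : Fin n → Finset (Fin s)) (q : Fin s → ℝ), Basic p H q ∧
      (∀ i, (H i).Nonempty → Happy w δ H q i) ∧ N * δ ≤ ∑ x, q x := by
    intro N
    induction N with
    | zero =>
      refine ⟨fun _ => ∅, fun _ => p, ⟨by simp, by simp, by simp⟩, by simp, ?_⟩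
      simp only [Nat.cast_zero, zero_mul]
      exact Finset.sum_nonneg fun _ _ => hp
    | succ N ih =>
      obtain ⟨H, q, hB, hH, hN⟩ := ih
      obtain ⟨H', q', hB', hH', hs⟩ := auction_step w w0 p δ hδ H q hB hH (by
        have := hcon H q hB
        push Not
        exact this)
      refine ⟨H', q', hB', hH', ?_⟩
      push_cast
      linarith
  obtain ⟨N, hN⟩ := exists_nat_gt ((s * (p + V + δ)) / δ)
  obtain ⟨H, q, hB, hH, hs⟩ := key N
  have h1 : ∑ x, q x ≤ ∑ _x : Fin s, (p + V + δ) :=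
    Finset.sum_le_sum fun x _ => price_bound w w0 p δ V hp hδ.le hV0 hV H q hB hH x
  simp only [sum_const, card_univ, Fintype.card_fin, nsmul_eq_mul] at h1
  rw [div_lt_iff₀ hδ] at hN
  linarith

lemma auction_exact {n s : ℕ} (w : Fin n → Finset (Fin s) → ℝ) (w0 : ∀ i, w i ∅ = 0)
    (p V : ℝ) (hp : 0 ≤ p) (hV0 : 0 ≤ V) (hV : ∀ i S, w i S ≤ V) :
    ∃ (H : Fin n → Finset (Fin s)) (q : Fin s → ℝ), Basic p H q ∧
      ∀ i, Happy w 0 H q i := by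
  classical
  let K : (Fin n → Finset (Fin s)) → ℕ → Set (Fin s → ℝ) := fun H k =>
    {q | Basic p H q ∧ ∀ i, Happy w (1 / ((k : ℝ) + 1)) H q i}
  have hmono : ∀ H k l, k ≤ l → K H l ⊆ K H k := by
    rintro H k l hkl q ⟨hB, hH⟩
    refine ⟨hB, fun i T hT => ?_⟩
    have h1 := hH i T hT
    have h2 : 1 / ((l : ℝ) + 1) ≤ 1 / ((k : ℝ) + 1) := Nat.one_div_le_one_div hkl
    linarith
  have hclosed : ∀ H k, IsClosed (K H k) := by
    intro H k
    have : K H k = {q | ∀ i j, i ≠ j → Disjoint (H i) (H j)} ∩ (⋂ x, {q | p ≤ q x}) ∩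
        (⋂ x, ⋂ (_ : ∀ j, x ∉ H j), {q | q x = p}) ∩
        (⋂ i, ⋂ T, ⋂ (_ : Adm H T), {q | w i T - ∑ x ∈ T, q x - (1 / ((k : ℝ) + 1)) ≤
          w i (H i) - ∑ x ∈ H i, q x}) := by
      ext q
      simp only [K, Set.mem_ofPred_eq, Set.mem_inter_iff, Set.mem_iInter, Happy]
      constructor
      · rintro ⟨⟨a, b, c⟩, d⟩
        exact ⟨⟨⟨a, b⟩, c⟩, d⟩
      · rintro ⟨⟨⟨a, b⟩, c⟩, d⟩
        exact ⟨⟨a, b, c⟩, d⟩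
    rw [this]
    refine ((isClosed_const.inter (isClosed_iInter fun x => ?_)).inter
      (isClosed_iInter fun x => isClosed_iInter fun _ => ?_)).inter
      (isClosed_iInter fun i => isClosed_iInter fun T => isClosed_iInter fun _ => ?_)
    · exact isClosed_le (by fun_prop) (by fun_prop)
    · exact isClosed_eq (by fun_prop) (by fun_prop)
    · exact isClosed_le (by fun_prop) (by fun_prop)
  have hex : ∃ H, ∀ k, (K H k).Nonempty := by
    by_contra hcon
    push Not at hcon
    choose f hf using hcon
    let N := Finset.univ.sup f
    obtain ⟨H, q, hB, hH⟩ := auction_delta w w0 p (1 / ((N : ℝ) + 1)) V hp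
      Nat.one_div_pos_of_nat hV0 hV
    have h1 : q ∈ K H (f H) := hmono H (f H) N (Finset.le_sup (Finset.mem_univ H)) ⟨hB, hH⟩
    rw [hf H] at h1
    exact h1
  obtain ⟨H, hne⟩ := hex
  have hcomp : IsCompact (K H 0) := by
    apply IsCompact.of_isClosed_subset (isCompact_Icc (a := fun _ : Fin s => p)
      (b := fun _ : Fin s => p + V + 1)) (hclosed H 0)
    rintro q ⟨hB, hH⟩
    refine ⟨fun x => hB.low x, fun x => ?_⟩
    have := price_bound w w0 p (1 / (((0:ℕ) : ℝ) + 1)) V hp (by norm_num) hV0 hV H q hB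
      (fun i _ => hH i) x
    simpa using this
  obtain ⟨q, hq⟩ := IsCompact.nonempty_iInter_of_sequence_nonempty_isCompact_isClosed (K H)
    (fun k => hmono H k (k+1) (Nat.le_succ k)) hne hcomp (hclosed H)
  rw [Set.mem_iInter] at hq
  refine ⟨H, q, (hq 0).1, fun i T hT => ?_⟩
  have h1 : ∀ k : ℕ, w i T - ∑ x ∈ T, q x - (w i (H i) - ∑ x ∈ H i, q x) ≤ 1 / ((k : ℝ) + 1) := by
    intro k
    have := (hq k).2 i T hT
    linarith
  have h2 := ge_of_tendsto' (tendsto_one_div_add_atTop_nhds_zero_nat (𝕜 := ℝ)) h1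
  linarith

/-- Clearing the market using dedicated consumers. -/
lemma auction_clear {n s : ℕ} (w : Fin n → Finset (Fin s) → ℝ) (w0 : ∀ i, w i ∅ = 0)
    (p V : ℝ) (hp : 0 ≤ p) (hV0 : 0 ≤ V) (hV : ∀ i S, w i S ≤ V)
    (D : Fin s → Fin s → Fin n) (hD : ∀ g a g' a', D g a = D g' a' → g = g' ∧ a = a')
    (hDp : ∀ g a, p ≤ w (D g a) {g}) :
    ∃ (H : Fin n → Finset (Fin s)) (q : Fin s → ℝ),
      (∀ i j, i ≠ j → Disjoint (H i) (H j)) ∧ (∀ x, ∃ j, x ∈ H j) ∧ (∀ x, p ≤ q x) ∧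
      ∀ i, Happy w 0 H q i := by
  classical
  obtain ⟨H, q, hB, hH⟩ := auction_exact w w0 p V hp hV0 hV
  have hempty : ∀ g, (∀ j, g ∉ H j) → ∃ a, H (D g a) = ∅ := by
    intro g hg
    by_contra hcon
    push Not at hcon
    choose f hf using fun a => hcon a
    have hinj : Function.Injective f := by
      intro a b hab
      by_contra hne
      have : D g a ≠ D g b := fun h => hne (hD _ _ _ _ h).2
      exact Finset.disjoint_left.mp (hB.disj _ _ this) (hf a) (hab ▸ hf b)
    obtain ⟨a, ha⟩ := (Finite.injective_iff_surjective.mp hinj) g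
    exact hg _ (ha ▸ hf a)
  let d : Fin s → Fin n := fun g =>
    if h : ∀ j, g ∉ H j then D g (hempty g h).choose else D g g
  have hd : ∀ g, (∀ j, g ∉ H j) → H (d g) = ∅ := by
    intro g h
    simp only [d, dif_pos h]
    exact (hempty g h).choose_spec
  have hdD : ∀ g, ∃ a, d g = D g a := by
    intro g
    by_cases h : ∀ j, g ∉ H j
    · exact ⟨_, by simp only [d, dif_pos h]; rfl⟩
    · exact ⟨g, by simp only [d, dif_neg h]⟩
  have hdinj : ∀ g g', d g = d g' → g = g' := by
    intro g g' h
    obtain ⟨a, ha⟩ := hdD g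
    obtain ⟨b, hb⟩ := hdD g'
    rw [ha, hb] at h
    exact (hD _ _ _ _ h).1
  let H' : Fin n → Finset (Fin s) := fun j =>
    H j ∪ univ.filter (fun g => (∀ j, g ∉ H j) ∧ d g = j)
  have hmem : ∀ j x, x ∈ H' j ↔ x ∈ H j ∨ ((∀ j, x ∉ H j) ∧ d x = j) := by
    intro j x; simp [H']
  refine ⟨H', q, ?_, ?_, hB.low, ?_⟩
  · intro i j hij
    rw [Finset.disjoint_left]
    intro x hx hx'
    rw [hmem] at hx hx'
    rcases hx with hx | hx <;> rcases hx' with hx' | hx'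
    · exact Finset.disjoint_left.mp (hB.disj i j hij) hx hx'
    · exact hx'.1 _ hx
    · exact hx.1 _ hx'
    · exact hij (hx.2.symm.trans hx'.2)
  · intro x
    by_cases h : ∀ j, x ∉ H j
    · exact ⟨d x, (hmem _ _).2 (Or.inr ⟨h, rfl⟩)⟩
    · push Not at h
      obtain ⟨j, hj⟩ := h
      exact ⟨j, (hmem _ _).2 (Or.inl hj)⟩
  · intro i T hT
    have hTA : Adm H T := fun j => by
      have hsub : H j ⊆ H' j := Finset.subset_union_left
      rcases hT j with h | h
      · exact Or.inl (hsub.trans h)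
      · exact Or.inr (h.mono_left hsub)
    have h1 := hH i T hTA
    by_cases h : ∃ g, (∀ j, g ∉ H j) ∧ d g = i
    · obtain ⟨g, hg, rfl⟩ := h
      have h2 : H' (d g) = {g} := by
        ext x
        rw [hmem, hd g hg, Finset.mem_singleton]
        constructor
        · rintro (h | ⟨_, h⟩)
          · simp at h
          · exact hdinj _ _ h
        · rintro rfl
          exact Or.inr ⟨hg, rfl⟩
      rw [hd g hg, w0] at h1
      rw [h2]
      obtain ⟨a, ha⟩ := hdD g
      have h3 := hDp g a
      rw [← ha] at h3
      simp only [sum_empty, sum_singleton] at h1 ⊢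
      rw [hB.unheld g hg]
      linarith
    · have h2 : H' i = H i := by
        ext x
        rw [hmem]
        constructor
        · rintro (h' | h')
          · exact h'
          · exact absurd ⟨x, h'⟩ h
        · exact Or.inl
      rw [h2]; exact h1

/-- Building a CBE from an allocation with bundle prices. -/
lemma mkCBE {n m : ℕ} (hn : 1 ≤ n) (Mk : Market n m) (H : Fin n → Finset (Fin m)) (q : Fin n → ℝ)
    (hdis : ∀ i j, i ≠ j → Disjoint (H i) (H j)) (hcov : ∀ x, ∃ j, x ∈ H j)
    (hq : ∀ i, 0 ≤ q i) (hq0 : ∀ i, H i = ∅ → q i = 0)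
    (hmax : ∀ i, ∀ J : Finset (Fin n), Mk.v i (J.biUnion H) - ∑ j ∈ J, q j ≤ Mk.v i (H i) - q i) :
    ∃ E : CBE Mk, E.welfare = ∑ i, Mk.v i (H i) := by
  classical
  have hinj : ∀ i j, (H i).Nonempty → H i = H j → i = j := by
    intro i j ⟨x, hx⟩ h
    by_contra hne
    exact Finset.disjoint_left.mp (hdis i j hne) hx (h ▸ hx)
  let asg : Finset (Fin m) → Fin n := fun b =>
    if h : ∃ j, H j = b then h.choose else ⟨0, hn⟩
  have hasg : ∀ j, (H j).Nonempty → asg (H j) = j := by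
    intro j hj
    have h : ∃ j', H j' = H j := ⟨j, rfl⟩
    simp only [asg, dif_pos h]
    exact (hinj j _ hj h.choose_spec.symm).symm
  let I : Finset (Fin n) := univ.filter (fun j => (H j).Nonempty)
  let B := I.image H
  have hBmem : ∀ b, b ∈ B ↔ ∃ j, (H j).Nonempty ∧ H j = b := by
    intro b; simp [B, I]
  have hfil : ∀ i, (B.filter fun b => asg b = i) = if (H i).Nonempty then {H i} else ∅ := by
    intro i
    ext b
    rw [Finset.mem_filter, hBmem]
    constructor
    · rintro ⟨⟨j, hj, rfl⟩, h⟩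
      rw [hasg j hj] at h
      subst h
      simp [hj]
    · intro h
      split_ifs at h with h1
      · rw [Finset.mem_singleton] at h
        subst h
        exact ⟨⟨i, h1, rfl⟩, hasg i h1⟩
      · simp at h
  have hun : ∀ i, (B.filter fun b => asg b = i).biUnion id = H i := by
    intro i
    rw [hfil]
    split_ifs with h
    · simp
    · rw [Finset.not_nonempty_iff_eq_empty] at h
      simp [h]
  have hpr : ∀ i, ∑ b ∈ B.filter (fun b => asg b = i), q (asg b) = q i := by
    intro i
    rw [hfil]
    split_ifs with h
    · simp [hasg i h]
    · rw [Finset.not_nonempty_iff_eq_empty] at h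
      simp [hq0 i h]
  refine ⟨⟨B, fun b => q (asg b), asg, ?_, ?_, ?_, ?_, ?_⟩, ?_⟩
  · intro b hb
    obtain ⟨j, hj, rfl⟩ := (hBmem b).1 hb
    exact hj
  · intro b hb b' hb' hne
    obtain ⟨j, hj, rfl⟩ := (hBmem b).1 hb
    obtain ⟨j', hj', rfl⟩ := (hBmem b').1 hb'
    exact hdis _ _ (fun h => hne (h ▸ rfl))
  · ext x
    simp only [Finset.mem_biUnion, id, Finset.mem_univ, iff_true]
    obtain ⟨j, hj⟩ := hcov x
    exact ⟨H j, (hBmem _).2 ⟨j, ⟨x, hj⟩, rfl⟩, hj⟩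
  · intro b _; exact hq _
  · intro i T hT
    have hTim : T = (T.image asg).image H := by
      ext b
      simp only [Finset.mem_image, exists_exists_and_eq_and]
      constructor
      · intro hb
        obtain ⟨j, hj, rfl⟩ := (hBmem b).1 (hT hb)
        exact ⟨H j, hb, by rw [hasg j hj]⟩
      · rintro ⟨b', hb', rfl⟩
        obtain ⟨j, hj, rfl⟩ := (hBmem b').1 (hT hb')
        rw [hasg j hj]; exact hb'
    have h1 : T.biUnion id = (T.image asg).biUnion H := by
      conv_lhs => rw [hTim]
      rw [Finset.image_biUnion]; rfl
    have h2 : ∑ b ∈ T, q (asg b) = ∑ j ∈ T.image asg, q j := by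
      rw [Finset.sum_image]
      intro b hb b' hb' h
      obtain ⟨j, hj, rfl⟩ := (hBmem b).1 (hT hb)
      obtain ⟨j', hj', rfl⟩ := (hBmem b').1 (hT hb')
      rw [hasg j hj, hasg j' hj'] at h
      rw [h]
    rw [hun, hpr, h1, h2]
    exact hmax i _
  · unfold CBE.welfare
    exact Finset.sum_congr rfl fun i _ => by rw [hun]

lemma v_nonneg {n m : ℕ} (Mk : Market n m) (i : Fin n) (S : Finset (Fin m)) : 0 ≤ Mk.v i S := by
  rw [← Mk.v_empty i]; exact Mk.v_mono i _ _ (Finset.empty_subset S)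

lemma group_CBE {n m s : ℕ} (hn : 1 ≤ n) (Mk : Market n m) (p : ℝ) (hp : 0 ≤ p)
    (l : Fin m → Fin s)
    (D : Fin s → Fin s → Fin n) (hD : ∀ g a g' a', D g a = D g' a' → g = g' ∧ a = a')
    (hDp : ∀ g a, p ≤ Mk.v (D g a) (univ.filter fun x => l x = g)) :
    ∃ E : CBE Mk, s * p ≤ E.welfare := by
  classical
  let pre : Finset (Fin s) → Finset (Fin m) := fun X => univ.filter fun x => l x ∈ X
  have hpre0 : pre ∅ = ∅ := by simp [pre]
  let w : Fin n → Finset (Fin s) → ℝ := fun i X => Mk.v i (pre X)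
  have w0 : ∀ i, w i ∅ = 0 := fun i => by simp only [w, hpre0, Mk.v_empty]
  have hle : ∀ i S, w i S ≤ ∑ j, Mk.v j univ := fun i S =>
    (Mk.v_mono i _ _ (Finset.subset_univ _)).trans
      (Finset.single_le_sum (f := fun j => Mk.v j univ) (fun j _ => v_nonneg Mk j _)
        (Finset.mem_univ i))
  obtain ⟨H, q, hdis, hcov, hq, hH⟩ := auction_clear w w0 p _ hp
    (Finset.sum_nonneg fun j _ => v_nonneg Mk j univ) hle D hD (by
      intro g a
      have := hDp g a
      simpa [w, pre] using this)
  have hqs : ∀ X : Finset (Fin s), 0 ≤ ∑ x ∈ X, q x :=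
    fun X => Finset.sum_nonneg fun x _ => hp.trans (hq x)
  -- prices of bundles with an empty preimage are not an issue: we charge zero then
  have hprof : ∀ i, ∑ x ∈ H i, q x ≤ w i (H i) := by
    intro i
    have := hH i ∅ (fun j => Or.inr (by simp))
    simp only [w0, sum_empty] at this
    linarith
  obtain ⟨E, hE⟩ := mkCBE hn Mk (fun i => pre (H i)) (fun i => ∑ x ∈ H i, q x)
    (by
      intro i j hij
      rw [Finset.disjoint_left]
      intro x hx hx'
      simp only [pre, Finset.mem_filter] at hx hx'
      exact Finset.disjoint_left.mp (hdis i j hij) hx.2 hx'.2)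
    (by
      intro x
      obtain ⟨j, hj⟩ := hcov (l x)
      exact ⟨j, by simpa [pre] using hj⟩)
    (fun i => hqs _)
    (by
      intro i hi
      have h1 := hprof i
      have h2 : w i (H i) = 0 := by
        simp only [w]; rw [hi, Mk.v_empty]
      have := hqs (H i)
      linarith)
    (by
      intro i J
      have h1 : J.biUnion (fun i => pre (H i)) = pre (J.biUnion H) := by
        ext x; simp [pre]
      have h2 : ∑ j ∈ J, ∑ x ∈ H j, q x = ∑ x ∈ J.biUnion H, q x := by
        rw [Finset.sum_biUnion]
        intro a _ b _ hab
        exact hdis a b hab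
      have h3 : Adm H (J.biUnion H) := by
        intro j
        by_cases hj : j ∈ J
        · exact Or.inl (Finset.subset_biUnion_of_mem H hj)
        · right
          rw [Finset.disjoint_biUnion_right]
          intro k hk
          exact hdis _ _ (fun h => hj (h ▸ hk))
      have h4 := hH i _ h3
      rw [h1, h2]
      simp only [w] at h4
      linarith)
  refine ⟨E, ?_⟩
  rw [hE]
  have h1 : ∑ i, ∑ x ∈ H i, q x = ∑ x, q x := by
    rw [← Finset.sum_biUnion (fun a _ b _ hab => hdis a b hab)]
    congr 1
    ext x
    simpa using hcov x
  have h2 : (s : ℝ) * p ≤ ∑ x, q x := by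
    have : ∑ _x : Fin s, p ≤ ∑ x, q x := Finset.sum_le_sum fun x _ => hq x
    simpa using this
  have h3 : ∑ i, ∑ x ∈ H i, q x ≤ ∑ i, Mk.v i (pre (H i)) :=
    Finset.sum_le_sum fun i _ => hprof i
  linarith

lemma sum_le_sqrt {ι : Type*} [DecidableEq ι] (f : ι → ℝ) (M : ℝ) (hM : 0 ≤ M) :
    ∀ (c : ℕ) (A : Finset ι), A.card = c →
    (∀ i ∈ A, 0 ≤ f i) →
    (∀ i ∈ A, f i * Real.sqrt ((A.filter fun j => f i ≤ f j).card) ≤ M) →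
    ∑ i ∈ A, f i ≤ 2 * Real.sqrt c * M := by
  intro c
  induction c with
  | zero =>
    intro A hA _ _
    rw [Finset.card_eq_zero] at hA
    simp [hA]
  | succ c ih =>
    intro A hA hf h
    have hne : A.Nonempty := by rw [← Finset.card_pos]; omega
    obtain ⟨a, ha, hmin⟩ := Finset.exists_min_image A f hne
    have h1 := ih (A.erase a) (by rw [Finset.card_erase_of_mem ha, hA]; rfl)
      (fun i hi => hf i (Finset.mem_of_mem_erase hi)) (by
        intro i hi
        have hi' := Finset.mem_of_mem_erase hi
        refine le_trans (mul_le_mul_of_nonneg_left ?_ (hf i hi')) (h i hi')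
        apply Real.sqrt_le_sqrt
        exact_mod_cast Finset.card_le_card
          (Finset.filter_subset_filter _ (Finset.erase_subset _ _)))
    have h2 := h a ha
    rw [Finset.filter_true_of_mem (fun j hj => hmin j hj), hA] at h2
    rw [← Finset.add_sum_erase A f ha]
    have hx : 0 < Real.sqrt ((c + 1 : ℕ) : ℝ) := Real.sqrt_pos.mpr (by positivity)
    have hy : 0 ≤ Real.sqrt (c : ℝ) := Real.sqrt_nonneg _
    have hx2 : Real.sqrt ((c + 1 : ℕ) : ℝ) ^ 2 = c + 1 := by
      rw [Real.sq_sqrt (by positivity)]; push_cast; ring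
    have hy2 : Real.sqrt (c : ℝ) ^ 2 = c := Real.sq_sqrt (by positivity)
    set x := Real.sqrt ((c + 1 : ℕ) : ℝ)
    set y := Real.sqrt (c : ℝ)
    have h3 : f a ≤ M / x := by rw [le_div_iff₀ hx]; exact h2
    have h4 : 1 / x ≤ 2 * x - 2 * y := by
      rw [div_le_iff₀ hx]
      nlinarith [sq_nonneg (x - y)]
    have h5 : M / x ≤ (2 * x - 2 * y) * M := by
      calc M / x = 1 / x * M := by ring
        _ ≤ _ := mul_le_mul_of_nonneg_right h4 hM
    nlinarith

lemma main_alloc {n m : ℕ} (hn : 1 ≤ n) (hm : 1 ≤ m) (Mk : Market n m)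
    (S : Fin n → Finset (Fin m)) (hS : IsAllocation S) :
    ∃ E : CBE Mk, allocWelfare Mk S ≤ 4 * Real.sqrt m * E.welfare := by
  classical
  let f : Fin n → ℝ := fun i => Mk.v i (S i)
  let A : Finset (Fin n) := univ.filter fun i => (S i).Nonempty
  have hAmem : ∀ i, i ∈ A ↔ (S i).Nonempty := by simp [A]
  have hsum : allocWelfare Mk S = ∑ i ∈ A, f i := by
    unfold allocWelfare
    symm
    apply Finset.sum_subset (Finset.subset_univ _)
    intro i _ hi
    rw [hAmem, Finset.not_nonempty_iff_eq_empty] at hi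
    simp only [f, hi, Mk.v_empty]
  have hAcard : A.card ≤ m := by
    have h1 : A.card ≤ (A.biUnion S).card :=
      Finset.card_le_card_biUnion (fun a _ b _ hab => hS a b hab) (fun i hi => (hAmem i).1 hi)
    exact h1.trans ((Finset.card_le_univ _).trans (by simp))
  rcases A.eq_empty_or_nonempty with hA | hA
  · obtain ⟨E, hE⟩ := group_CBE (s := 1) hn Mk 0 le_rfl (fun _ => 0) (fun _ _ => ⟨0, hn⟩)
      (fun g a g' a' _ => ⟨Subsingleton.elim _ _, Subsingleton.elim _ _⟩)
      (fun g a => v_nonneg Mk _ _)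
    refine ⟨E, ?_⟩
    rw [hsum, hA, Finset.sum_empty]
    simp only [mul_zero] at hE
    positivity
  obtain ⟨i, hi, hmax⟩ := Finset.exists_max_image A
    (fun i => f i * Real.sqrt ((A.filter fun j => f i ≤ f j).card)) hA
  have hf0 : ∀ i, 0 ≤ f i := fun i => v_nonneg Mk _ _
  have hW := sum_le_sqrt f _ (mul_nonneg (hf0 i) (Real.sqrt_nonneg _)) A.card A rfl
    (fun i _ => hf0 i) hmax
  set C := A.filter fun j => f i ≤ f j with hC
  set s := Nat.sqrt C.card with hs
  have hCpos : 0 < C.card := Finset.card_pos.mpr ⟨i, by simp [hC, hi]⟩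
  have hspos : 0 < s := Nat.sqrt_pos.mpr hCpos
  have hs2 : Fintype.card (Fin s × Fin s) ≤ Fintype.card C := by
    simp only [Fintype.card_prod, Fintype.card_fin, Fintype.card_coe]
    exact Nat.sqrt_le _
  obtain ⟨e⟩ := Function.Embedding.nonempty_of_card_le hs2
  let D : Fin s → Fin s → Fin n := fun g a => (e (g, a) : Fin n)
  have hD : ∀ g a g' a', D g a = D g' a' → g = g' ∧ a = a' := by
    intro g a g' a' h
    have := e.injective (Subtype.ext h)
    simpa using this
  let l : Fin m → Fin s := fun x =>
    if h : ∃ g a, x ∈ S (D g a) then h.choose else ⟨0, hspos⟩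
  have hl : ∀ g a x, x ∈ S (D g a) → l x = g := by
    intro g a x hx
    have h : ∃ g a, x ∈ S (D g a) := ⟨g, a, hx⟩
    simp only [l, dif_pos h]
    obtain ⟨a', ha'⟩ := h.choose_spec
    by_contra hne
    exact Finset.disjoint_left.mp (hS _ _ (fun h' => hne (hD _ _ _ _ h').1)) ha' hx
  obtain ⟨E, hE⟩ := group_CBE hn Mk (f i) (hf0 i) l D hD (by
    intro g a
    have h1 : f i ≤ f (D g a) := (Finset.mem_filter.mp (e (g, a)).2).2
    refine h1.trans (Mk.v_mono _ _ _ ?_)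
    intro x hx
    simpa using hl g a x hx)
  refine ⟨E, ?_⟩
  rw [hsum]
  have h1 : Real.sqrt (C.card : ℝ) ≤ 2 * s := by
    rw [Real.sqrt_le_left (by positivity)]
    have h2 : C.card < (s + 1) * (s + 1) := Nat.lt_succ_sqrt _
    have h3 : C.card ≤ (2 * s) ^ 2 := by nlinarith
    exact_mod_cast h3
  have h2 : Real.sqrt (A.card : ℝ) ≤ Real.sqrt m := Real.sqrt_le_sqrt (by exact_mod_cast hAcard)
  have h3 : f i * Real.sqrt (C.card : ℝ) ≤ 2 * E.welfare := by
    have := mul_le_mul_of_nonneg_left h1 (hf0 i)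
    linarith
  have h4 : 0 ≤ f i * Real.sqrt (C.card : ℝ) := mul_nonneg (hf0 i) (Real.sqrt_nonneg _)
  calc ∑ i ∈ A, f i ≤ 2 * Real.sqrt A.card * (f i * Real.sqrt (C.card : ℝ)) := hW
    _ ≤ 2 * Real.sqrt m * (2 * E.welfare) := by gcongr
    _ = _ := by ring

/-- There is an absolute constant `c > 0` such that for every market and
every `k ∈ {1, …, m}`, there is a CBE with welfare at least
`c * W_k / (√(k·m) * (log₂ m + 2))`, where `W_k` is the maximum welfare over allocations
whose nonempty parts have size in `[k, 2k)`. -/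
theorem bounded_size_allocation_approx :
    ∃ c : ℝ, 0 < c ∧
      ∀ (n m : ℕ), 1 ≤ n → 1 ≤ m → ∀ (Mk : Market n m), ∀ k : ℕ, 1 ≤ k → k ≤ m →
        ∃ E : CBE Mk,
          E.welfare ≥
            c * sSup {w : ℝ | ∃ S : Fin n → Finset (Fin m), IsAllocation S ∧
                  (∀ i, (S i).Nonempty → k ≤ (S i).card ∧ (S i).card < 2 * k) ∧
                  allocWelfare Mk S = w}
              / (Real.sqrt ((k : ℝ) * m) * (Real.logb 2 m + 2)) := by
  refine ⟨1 / 4, by norm_num, ?_⟩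
  intro n m hn hm Mk k hk hkm
  set W := {w : ℝ | ∃ S : Fin n → Finset (Fin m), IsAllocation S ∧
                  (∀ i, (S i).Nonempty → k ≤ (S i).card ∧ (S i).card < 2 * k) ∧
                  allocWelfare Mk S = w} with hW
  have hfin : W.Finite := by
    apply (Set.finite_range (fun S : Fin n → Finset (Fin m) => allocWelfare Mk S)).subset
    rintro w ⟨S, _, _, h⟩
    exact ⟨S, h⟩
  have hne : W.Nonempty := ⟨_, fun _ => ∅, fun _ _ _ => by simp, fun _ h => by simp at h, rfl⟩
  obtain ⟨S, hS, _, hSw⟩ := hne.csSup_mem hfin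
  obtain ⟨E, hE⟩ := main_alloc hn hm Mk S hS
  refine ⟨E, ?_⟩
  rw [← hSw]
  have hE0 : 0 ≤ E.welfare := Finset.sum_nonneg fun i _ => v_nonneg Mk i _
  have hm1 : (1 : ℝ) ≤ m := by exact_mod_cast hm
  have hk1 : (1 : ℝ) ≤ k := by exact_mod_cast hk
  have hlog : 0 ≤ Real.logb 2 m := Real.logb_nonneg (by norm_num) hm1
  have hsq : Real.sqrt m ≤ Real.sqrt ((k : ℝ) * m) := Real.sqrt_le_sqrt (by nlinarith)
  have hsm : 0 < Real.sqrt m := Real.sqrt_pos.mpr (by linarith)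
  have hden : Real.sqrt m ≤ Real.sqrt ((k : ℝ) * m) * (Real.logb 2 m + 2) := by nlinarith
  rw [ge_iff_le, div_le_iff₀ (by linarith)]
  have := mul_le_mul_of_nonneg_left hden hE0
  linarith
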